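/- Every exponential-polynomial instance of order at most 9 with 4 sequences is MSTV-reducible. (This is the paper's theorem that SimSkolem(9,4) is MSTV-reducible, hence decidable, and equivalently that the reduced Subspace Orbit Problem with inherent dimension 9 and target dimension 5 is decidable.) -/

import Mathlib

open scoped Classical

noncomputable section

/-- `ℚ̄`, a fixed algebraic closure of `ℚ`. -/
abbrev Qbar : Type := AlgebraicClosure ℚ

/-- An absolute value is non-Archimedean if it satisfies the ultrametric inequality. -/
def IsNonarch {L : Type*} [Field L] (v : AbsoluteValue L ℝ) : Prop :=
  ∀ x y : L, v (x + y) ≤ max (v x) (v y)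

/-- An absolute value is nontrivial if it takes a value `≠ 1` at some nonzero element. -/
def AbsNontrivial {L : Type*} [Field L] (v : AbsoluteValue L ℝ) : Prop :=
  ∃ x : L, x ≠ 0 ∧ v x ≠ 1

/-- An exponential-polynomial instance of order at most `d` with `k` sequences: distinct
nonzero roots `lam i` in `ℚ̄` whose ratios are not roots of unity, multiplicities `m i ≥ 1`
with `∑ m i ≤ d`, and `k` linearly independent coefficient vectors indexed by
`T = {(i, j) : j < m i}`. -/
structure ExpPolyInstance (d k : ℕ) where
  s : ℕ
  lam : Fin s → Qbar
  m : Fin s → ℕ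
  coeff : Fin k → ((i : Fin s) × Fin (m i)) → Qbar
  lam_ne_zero : ∀ i, lam i ≠ 0
  lam_injective : Function.Injective lam
  nondeg : ∀ i j, i ≠ j → ∀ n : ℕ, 1 ≤ n → (lam i / lam j) ^ n ≠ 1
  m_pos : ∀ i, 1 ≤ m i
  order_le : (∑ i, m i) ≤ d
  indep : LinearIndependent Qbar coeff

/-- A nonzero vector `w : T → ℚ̄` lies in the MSTV class (relative to the roots `lam`) if
there are a number field `L ⊆ ℚ̄` containing the roots and a nontrivial absolute value `v` on
`L` such that among the indices `i` with some `w (i, j) ≠ 0`, the number of `v`-dominant ones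
is at most `2` when `v` is non-Archimedean and at most `3` when `v` is Archimedean. -/
def InMSTV {s : ℕ} {m : Fin s → ℕ} (lam : Fin s → Qbar)
    (w : ((i : Fin s) × Fin (m i)) → Qbar) : Prop :=
  w ≠ 0 ∧
  ∃ (L : IntermediateField ℚ Qbar) (hmem : ∀ i, lam i ∈ L),
    FiniteDimensional ℚ L ∧
    ∃ v : AbsoluteValue L ℝ, AbsNontrivial v ∧
      (IsNonarch v →
        (Finset.univ.filter (fun i : Fin s =>
          (∃ j, w ⟨i, j⟩ ≠ 0) ∧
          ∀ i' : Fin s, (∃ j', w ⟨i', j'⟩ ≠ 0) →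
            v ⟨lam i', hmem i'⟩ ≤ v ⟨lam i, hmem i⟩)).card ≤ 2) ∧
      (¬ IsNonarch v →
        (Finset.univ.filter (fun i : Fin s =>
          (∃ j, w ⟨i, j⟩ ≠ 0) ∧
          ∀ i' : Fin s, (∃ j', w ⟨i', j'⟩ ≠ 0) →
            v ⟨lam i', hmem i'⟩ ≤ v ⟨lam i, hmem i⟩)).card ≤ 3)

/-- An instance is MSTV-reducible if some nonzero linear combination of its coefficient
vectors lies in the MSTV class. -/
def MSTVReducible {d k : ℕ} (I : ExpPolyInstance d k) : Prop :=
  ∃ β : Fin k → Qbar, β ≠ 0 ∧ InMSTV I.lam (∑ p, β p • I.coeff p)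

section NumberTheory

variable {L : Type*} [Field L]

/-- Kronecker's theorem: an element of a number field all of whose absolute values are `1` is a
root of unity. -/
theorem exists_pow_eq_one_of_forall_absoluteValue_eq_one [NumberField L] {y : L}
    (hy : ∀ v : AbsoluteValue L ℝ, v y = 1) : ∃ n : ℕ, 1 ≤ n ∧ y ^ n = 1 := by
  have hint : IsIntegral ℤ y := by
    obtain ⟨z, rfl⟩ := IsDedekindDomain.HeightOneSpectrum.mem_integers_of_valuation_le_one
      (R := NumberField.RingOfIntegers L) L y fun v => by
        have h := hy (v.adicAbv (K := L) (b := 2) (by norm_num))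
        simp only [IsDedekindDomain.HeightOneSpectrum.adicAbv,
          IsDedekindDomain.HeightOneSpectrum.adicAbvDef, AbsoluteValue.coe_mk, MulHom.coe_mk,
          NNReal.coe_eq_one] at h
        exact (WithZeroMulInt.toNNReal_le_one_iff (by norm_num)).1 h.le
    exact NumberField.RingOfIntegers.isIntegral_coe z
  obtain ⟨n, hn, h⟩ := NumberField.Embeddings.pow_eq_one_of_norm_eq_one L ℂ hint
    fun φ => hy (NumberField.place φ)
  exact ⟨n, hn, h⟩

theorem absNontrivial_place [CharZero L] (φ : L →+* ℂ) : AbsNontrivial (NumberField.place φ) :=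
  ⟨2, two_ne_zero, by rw [NumberField.place_apply, map_ofNat]; norm_num⟩

theorem not_isNonarch_place (φ : L →+* ℂ) : ¬ IsNonarch (NumberField.place φ) := by
  intro h
  have := h 1 1
  rw [one_add_one_eq_two, map_one, NumberField.place_apply, map_ofNat] at this
  norm_num at this

/-- Elements of a Galois number field lying on a common circle under one complex embedding cannot
have, at every absolute value, more than half of them dominant, unless their ratios are roots of
unity. Complex conjugation induces an automorphism reversing the order by absolute value. -/
theorem exists_card_dominant_le [NumberField L] [IsGalois ℚ L] {ι : Type*} (φ : L →+* ℂ)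
    {x : ι → L}
    (hx : ∀ i, x i ≠ 0) {D : Finset ι} (hD : 2 ≤ D.card)
    (hnd : ∀ i j, i ≠ j → ∀ n : ℕ, 1 ≤ n → (x i / x j) ^ n ≠ 1)
    (hφ : ∀ i ∈ D, ∀ j ∈ D, ‖φ (x i)‖ = ‖φ (x j)‖) :
    ∃ v : AbsoluteValue L ℝ, AbsNontrivial v ∧
      ∀ E ⊆ D, (∀ i ∈ E, ∀ j ∈ D, v (x j) ≤ v (x i)) → 2 * E.card ≤ D.card := by
  by_contra! H
  obtain ⟨σ, hσ⟩ := NumberField.ComplexEmbedding.exists_comp_symm_eq_of_comp_eq (k := ℚ) φ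
    (NumberField.ComplexEmbedding.conjugate φ) (Subsingleton.elim _ _)
  set τ : L →+* L := (σ.symm : L →+* L)
  have hconj : ∀ y, φ (τ y) = starRingEnd ℂ (φ y) := fun y => by
    have := congrArg (fun g : L →+* ℂ => g y) hσ
    simpa using this
  have hmul : ∀ i ∈ D, ∀ j ∈ D, x i * τ (x i) = x j * τ (x j) := fun i hi j hj => by
    apply φ.injective
    rw [map_mul, map_mul, hconj, hconj, Complex.mul_conj', Complex.mul_conj', hφ i hi j hj]
  have heq : ∀ v : AbsoluteValue L ℝ, ∀ i ∈ D, ∀ j ∈ D, v (x i) = v (x j) := by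
    intro v
    by_cases hv : AbsNontrivial v
    · obtain ⟨E, hE, hvE, h1⟩ := H v hv
      obtain ⟨F, hF, hvF, h2⟩ := H (v.comp τ.injective) (by
        obtain ⟨y, hy, hy1⟩ := hv
        exact ⟨σ y, by simpa using hy, by
          change v (σ.symm (σ y)) ≠ 1
          rwa [AlgEquiv.symm_apply_apply]⟩)
      obtain ⟨i₀, hi⟩ := Finset.inter_nonempty_of_card_lt_card_add_card hE hF (by omega)
      rw [Finset.mem_inter] at hi
      have hi₀ := hE hi.1
      have ha := hvE i₀ hi.1
      have hb := hvF i₀ hi.2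
      have key : ∀ j ∈ D, v (x j) = v (x i₀) := fun j hj => by
        have h3 := congrArg v (hmul j hj i₀ hi₀)
        rw [map_mul, map_mul] at h3
        have h4 : v (τ (x j)) ≤ v (τ (x i₀)) := hb j hj
        have h5 : 0 < v (τ (x i₀)) := v.pos (by simpa using hx i₀)
        have h6 := ha j hj
        have h7 : 0 < v (x j) := v.pos (hx j)
        refine le_antisymm h6 ?_
        by_contra! hlt
        nlinarith
      exact fun i hi j hj => (key i hi).trans (key j hj).symm
    · have h1 : ∀ y, y ≠ 0 → v y = 1 := fun y hy => by
        by_contra h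
        exact hv ⟨y, hy, h⟩
      exact fun i _ j _ => (h1 _ (hx i)).trans (h1 _ (hx j)).symm
  obtain ⟨i, hi, j, hj, hij⟩ := Finset.one_lt_card.1 hD
  obtain ⟨n, hn, h⟩ := exists_pow_eq_one_of_forall_absoluteValue_eq_one (y := x i / x j)
    fun v => by rw [map_div₀, heq v i hi j hj, div_self (v.pos (hx j)).ne']
  exact hnd i j hij n hn h

end NumberTheory

section Support

variable {K ι : Type*} [Field K] [Fintype ι] {m : ι → ℕ}

/-- The indices of the roots that actually occur in the exponential polynomial `w`. -/
def rootSupport (w : ((i : ι) × Fin (m i)) → K) : Finset ι :=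
  Finset.univ.filter fun i => ∃ j, w ⟨i, j⟩ ≠ 0

/-- The indices of the occurring roots at which `f` is maximal. -/
def dominantRoots (f : ι → ℝ) (w : ((i : ι) × Fin (m i)) → K) : Finset ι :=
  (rootSupport w).filter fun i => ∀ j ∈ rootSupport w, f j ≤ f i

/-- The coefficient vectors in which no root indexed by `A` occurs. -/
def vanishingOn (K : Type*) [Field K] (m : ι → ℕ) (A : Finset ι) :
    Submodule K (((i : ι) × Fin (m i)) → K) where
  carrier := {w | ∀ t, t.1 ∈ A → w t = 0}
  add_mem' ha hb t ht := by simp [ha t ht, hb t ht]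
  zero_mem' _ _ := rfl
  smul_mem' c w hw t ht := by simp [hw t ht]

theorem mem_vanishingOn_iff {A : Finset ι} {w : ((i : ι) × Fin (m i)) → K} :
    w ∈ vanishingOn K m A ↔ Disjoint (rootSupport w) A := by
  rw [Finset.disjoint_left]
  constructor
  · intro h i hi hA
    obtain ⟨j, hj⟩ := (Finset.mem_filter.1 hi).2
    exact hj (h ⟨i, j⟩ hA)
  · rintro h ⟨i, j⟩ hA
    by_contra hne
    exact h (Finset.mem_filter.2 ⟨Finset.mem_univ _, j, hne⟩) hA

theorem rootSupport_nonempty {w : ((i : ι) × Fin (m i)) → K} (hw : w ≠ 0) :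
    (rootSupport w).Nonempty := by
  obtain ⟨⟨i, j⟩, h⟩ := Function.ne_iff.1 hw
  exact ⟨i, Finset.mem_filter.2 ⟨Finset.mem_univ _, j, h⟩⟩

theorem finrank_le_finrank_inf_vanishingOn_add_card
    (W : Submodule K (((i : ι) × Fin (m i)) → K)) {B : Finset ι} (hB : ∀ i ∈ B, m i = 1) :
    Module.finrank K W ≤ Module.finrank K ↥(W ⊓ vanishingOn K m B) + B.card := by
  let f : W →ₗ[K] (B → K) :=
    { toFun := fun w b => w.1 ⟨b.1, ⟨0, by rw [hB b.1 b.2]; exact one_pos⟩⟩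
      map_add' := fun _ _ => rfl
      map_smul' := fun _ _ => rfl }
  have hker : (LinearMap.ker f).map W.subtype ≤ W ⊓ vanishingOn K m B := by
    rintro _ ⟨w, hw, rfl⟩
    refine ⟨w.2, ?_⟩
    rintro ⟨i, j⟩ hi
    have h := congrFun (LinearMap.mem_ker.1 hw) ⟨i, hi⟩
    have hj : j = ⟨0, by rw [hB i hi]; exact one_pos⟩ := by
      ext
      have := j.2
      have := hB i hi
      simp only
      omega
    rw [hj]
    exact h
  have h1 := Submodule.finrank_mono hker
  rw [Submodule.finrank_map_subtype_eq] at h1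
  have h2 := f.finrank_range_add_finrank_ker
  have h3 := Submodule.finrank_le (LinearMap.range f)
  rw [Module.finrank_fintype_fun_eq_card, Fintype.card_coe] at h3
  omega

/-- If all but at most one of the roots in `A` are simple, then some `w ∈ W` involves roots in
`A`, but at most `max 1 (|A| - n)` of them, where `n` is less than the rank of `W` on `A`. -/
theorem exists_card_rootSupport_inter_le
    (W : Submodule K (((i : ι) × Fin (m i)) → K)) {A : Finset ι}
    (hA : A.card ≤ (A.filter fun i => m i = 1).card + 1) {n : ℕ}
    (hn : n + Module.finrank K ↥(W ⊓ vanishingOn K m A) < Module.finrank K W) :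
    ∃ w ∈ W, (rootSupport w ∩ A).Nonempty ∧
      (rootSupport w ∩ A).card ≤ max 1 (A.card - n) := by
  obtain ⟨B, hBA, hB⟩ := Finset.exists_subset_card_eq
    (show min n (A.card - 1) ≤ (A.filter fun i => m i = 1).card by omega)
  have h1 := finrank_le_finrank_inf_vanishingOn_add_card W
    fun i hi => (Finset.mem_filter.1 (hBA hi)).2
  obtain ⟨w, hw, hwA⟩ : ∃ w ∈ W ⊓ vanishingOn K m B, w ∉ vanishingOn K m A := by
    by_contra! h
    have := Submodule.finrank_mono
      (show W ⊓ vanishingOn K m B ≤ W ⊓ vanishingOn K m A from fun w hw => ⟨hw.1, h w hw⟩)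
    omega
  have hne : (rootSupport w ∩ A).Nonempty := by
    rwa [mem_vanishingOn_iff, Finset.not_disjoint_iff_nonempty_inter] at hwA
  refine ⟨w, hw.1, hne, ?_⟩
  have hdisj := mem_vanishingOn_iff.1 hw.2
  have hsub : rootSupport w ∩ A ⊆ A \ B := fun i hi => by
    rw [Finset.mem_inter] at hi
    exact Finset.mem_sdiff.2 ⟨hi.2, Finset.disjoint_left.1 hdisj hi.1⟩
  have h2 := Finset.card_le_card hsub
  rw [Finset.card_sdiff_of_subset (hBA.trans (Finset.filter_subset _ _))] at h2
  omega

/-- If every nonzero `w ∈ W` involves at least five roots and has more than `c` dominant roots,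
then at least `c + 4` of the roots in `S` are dominant. -/
theorem exists_subset_max_add_four_le_card
    {W : Submodule K (((i : ι) × Fin (m i)) → K)} (hW : Module.finrank K W = 4)
    {S : Finset ι} (hS : ∀ w ∈ W, rootSupport w ⊆ S) (hSW : ∀ i ∈ S, ∃ w ∈ W, i ∈ rootSupport w)
    (hcard : S.card ≤ 9) (hne : S.Nonempty)
    (hsimple : ∀ A ⊆ S, A.card ≤ (A.filter fun i => m i = 1).card + 1)
    (hfive : ∀ w ∈ W, w ≠ 0 → 5 ≤ (rootSupport w).card)
    (f : ι → ℝ) {c : ℕ} (hc : 2 ≤ c)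
    (hdom : ∀ w ∈ W, w ≠ 0 → c < (dominantRoots f w).card) :
    ∃ A ⊆ S, (∀ i ∈ A, ∀ j ∈ S, f j ≤ f i) ∧ c + 4 ≤ A.card := by
  set A := S.filter fun i => ∀ j ∈ S, f j ≤ f i
  have hAS : A ⊆ S := Finset.filter_subset _ _
  refine ⟨A, hAS, fun i hi => (Finset.mem_filter.1 hi).2, ?_⟩
  have hnz : ∀ {w : ((i : ι) × Fin (m i)) → K} {B : Finset ι},
      (rootSupport w ∩ B).Nonempty → w ≠ 0 := by
    rintro w B ⟨i, hi⟩ rfl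
    simp [rootSupport] at hi
  set k := Module.finrank K ↥(W ⊓ vanishingOn K m A) with hk
  have hk4 : k < 4 := by
    obtain ⟨i, hi, hmax⟩ := S.exists_max_image f hne
    obtain ⟨w, hw, hiw⟩ := hSW i hi
    have hlt : W ⊓ vanishingOn K m A < W := by
      refine lt_of_le_of_ne inf_le_left fun h => ?_
      rw [← h] at hw
      exact Finset.disjoint_left.1 (mem_vanishingOn_iff.1 hw.2) hiw
        (Finset.mem_filter.2 ⟨hi, hmax⟩)
    have := Submodule.finrank_lt_finrank_of_lt hlt
    omega
  have hA : c + 4 - k ≤ A.card := by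
    obtain ⟨w, hw, ⟨i, hi⟩, hle⟩ := exists_card_rootSupport_inter_le W (hsimple A hAS)
      (n := 3 - k) (by omega)
    have hsub : dominantRoots f w ⊆ rootSupport w ∩ A := fun j hj => by
      obtain ⟨hj, hmax⟩ := Finset.mem_filter.1 hj
      rw [Finset.mem_inter] at hi ⊢
      refine ⟨hj, Finset.mem_filter.2 ⟨hS w hw hj, fun l hl => ?_⟩⟩
      exact ((Finset.mem_filter.1 hi.2).2 l hl).trans (hmax i hi.1)
    have h1 := Finset.card_le_card hsub
    have h2 := hdom w hw (hnz ⟨i, hi⟩)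
    omega
  rcases Nat.eq_zero_or_pos k with h0 | hpos
  · omega
  · exfalso
    have hbot : W ⊓ vanishingOn K m A ⊓ vanishingOn K m (S \ A) = ⊥ := by
      rw [eq_bot_iff]
      rintro w ⟨⟨hw, hwA⟩, hwS⟩
      by_contra hw0
      obtain ⟨i, hi⟩ := rootSupport_nonempty hw0
      exact Finset.disjoint_left.1 (mem_vanishingOn_iff.1 hwS) hi (Finset.mem_sdiff.2
        ⟨hS w hw hi, Finset.disjoint_left.1 (mem_vanishingOn_iff.1 hwA) hi⟩)
    obtain ⟨w, hw, hwne, hle⟩ := exists_card_rootSupport_inter_le (W ⊓ vanishingOn K m A)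
      (hsimple (S \ A) Finset.sdiff_subset) (n := k - 1) (by
        rw [hbot, finrank_bot, ← hk]
        omega)
    have hsub : rootSupport w ⊆ rootSupport w ∩ (S \ A) := fun i hi =>
      Finset.mem_inter.2 ⟨hi, Finset.mem_sdiff.2
        ⟨hS w hw.1 hi, Finset.disjoint_left.1 (mem_vanishingOn_iff.1 hw.2) hi⟩⟩
    have h1 := Finset.card_le_card hsub
    have h2 := hfive w hw.1 (hnz hwne)
    rw [Finset.card_sdiff_of_subset hAS] at hle
    omega

theorem two_mul_card_le_sum_add_card_filter {ι : Type*} {m : ι → ℕ} {S : Finset ι}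
    (hm : ∀ i ∈ S, 1 ≤ m i) :
    2 * S.card ≤ ∑ i ∈ S, m i + (S.filter fun i => m i = 1).card := by
  rw [Finset.card_filter, ← Finset.sum_add_distrib, mul_comm, ← smul_eq_mul]
  refine Finset.card_nsmul_le_sum _ _ _ fun i hi => ?_
  have := hm i hi
  split_ifs <;> omega

end Support

/-- A four-dimensional space of exponential polynomials of order at most `9` contains a nonzero
member having, at a suitable absolute value, at most two dominant roots, or at most three at the
place of a given complex embedding. -/
theorem exists_card_dominantRoots_le {L : Type*} [Field L] [NumberField L] [IsGalois ℚ L]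
    {K ι : Type*} [Field K] [Fintype ι] {m : ι → ℕ} (φ : L →+* ℂ) {x : ι → L}
    (hx : ∀ i, x i ≠ 0) (hnd : ∀ i j, i ≠ j → ∀ n : ℕ, 1 ≤ n → (x i / x j) ^ n ≠ 1)
    (hm : ∀ i, 1 ≤ m i) (hsum : ∑ i, m i ≤ 9)
    {W : Submodule K (((i : ι) × Fin (m i)) → K)} (hW : Module.finrank K W = 4) :
    ∃ w ∈ W, w ≠ 0 ∧
      ((∃ v : AbsoluteValue L ℝ, AbsNontrivial v ∧
        (dominantRoots (fun i => v (x i)) w).card ≤ 2) ∨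
      (dominantRoots (fun i => NumberField.place φ (x i)) w).card ≤ 3) := by
  by_contra! H
  have hfive : ∀ w ∈ W, w ≠ 0 → 5 ≤ (rootSupport w).card := by
    intro w hw hw0
    by_contra! hlt
    obtain ⟨h3, h4⟩ := H w hw hw0
    have hDS : dominantRoots (fun i => NumberField.place φ (x i)) w = rootSupport w :=
      Finset.eq_of_subset_of_card_le (Finset.filter_subset _ _) (by omega)
    have hD : ∀ i ∈ rootSupport w, ∀ j ∈ rootSupport w, ‖φ (x j)‖ ≤ ‖φ (x i)‖ := fun i hi => by
      rw [← hDS] at hi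
      exact (Finset.mem_filter.1 hi).2
    obtain ⟨v, hv, hle⟩ := exists_card_dominant_le φ hx (D := rootSupport w)
      (by rw [← hDS]; omega) hnd fun i hi j hj => le_antisymm (hD j hj i hi) (hD i hi j hj)
    have h5 := hle (dominantRoots (fun i => v (x i)) w) (Finset.filter_subset _ _)
      fun i hi => (Finset.mem_filter.1 hi).2
    have h6 := h3 v hv
    omega
  set S : Finset ι := Finset.univ.filter fun i => ∃ w ∈ W, i ∈ rootSupport w
  have hS : ∀ w ∈ W, rootSupport w ⊆ S := fun w hw i hi =>
    Finset.mem_filter.2 ⟨Finset.mem_univ _, w, hw, hi⟩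
  have hSW : ∀ i ∈ S, ∃ w ∈ W, i ∈ rootSupport w := fun i hi => (Finset.mem_filter.1 hi).2
  have hSsum : ∑ i ∈ S, m i ≤ 9 :=
    (Finset.sum_le_sum_of_subset (Finset.subset_univ S)).trans hsum
  have hsimp := two_mul_card_le_sum_add_card_filter (S := S) fun i _ => hm i
  have hS9 : S.card ≤ 9 := by
    have h := Finset.card_nsmul_le_sum S m 1 fun i _ => hm i
    rw [smul_eq_mul, mul_one] at h
    exact h.trans hSsum
  have hS8 : 8 ≤ S.card := by
    by_contra! hlt
    obtain ⟨B, hBS, hB⟩ := Finset.exists_subset_card_eq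
      (show S.card - 4 ≤ (S.filter fun i => m i = 1).card by omega)
    have h1 := finrank_le_finrank_inf_vanishingOn_add_card W
      fun i hi => (Finset.mem_filter.1 (hBS hi)).2
    have hne : W ⊓ vanishingOn K m B ≠ ⊥ := fun h => by
      rw [h, finrank_bot] at h1
      omega
    obtain ⟨w, hw, hw0⟩ := Submodule.exists_mem_ne_zero_of_ne_bot hne
    have hsub : rootSupport w ⊆ S \ B := fun i hi => Finset.mem_sdiff.2
      ⟨hS w hw.1 hi, Finset.disjoint_left.1 (mem_vanishingOn_iff.1 hw.2) hi⟩
    have h2 := Finset.card_le_card hsub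
    rw [Finset.card_sdiff_of_subset (hBS.trans (Finset.filter_subset _ _))] at h2
    have h3 := hfive w hw.1 hw0
    omega
  have hsimple : ∀ A ⊆ S, A.card ≤ (A.filter fun i => m i = 1).card + 1 := fun A hA => by
    have h1 := Finset.card_le_card (Finset.filter_subset_filter (fun i => ¬ m i = 1) hA)
    have h2 := A.card_filter_add_card_filter_not (fun i => m i = 1)
    have h3 := S.card_filter_add_card_filter_not (fun i => m i = 1)
    omega
  have hmax := fun f {c} => exists_subset_max_add_four_le_card hW hS hSW hS9
    (Finset.card_pos.1 (by omega)) hsimple hfive f (c := c)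
  obtain ⟨D, hDS, hDmax, hD⟩ := hmax (fun i => NumberField.place φ (x i)) (c := 3) (by norm_num)
    fun w hw hw0 => (H w hw hw0).2
  obtain ⟨v, hv, hle⟩ := exists_card_dominant_le φ hx (D := D) (by omega) hnd
    fun i hi j hj => le_antisymm (hDmax j hj i (hDS hi)) (hDmax i hi j (hDS hj))
  obtain ⟨A, hAS, hAmax, hA⟩ := hmax (fun i => v (x i)) le_rfl fun w hw hw0 => (H w hw hw0).1 v hv
  have h1 := hle (A ∩ D) Finset.inter_subset_right fun i hi j hj =>
    hAmax i (Finset.mem_inter.1 hi).1 j (hDS hj)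
  have h2 := Finset.card_union_add_card_inter A D
  have h3 := Finset.card_le_card (Finset.union_subset hAS hDS)
  omega

/-- `SimSkolem(9,4)` is MSTV-reducible. -/
theorem mstv_reducible_nine_four :
    ∀ I : ExpPolyInstance 9 4, MSTVReducible I := by
  intro I
  have halg : Algebra.IsAlgebraic ℚ Qbar := AlgebraicClosure.isAlgebraic ℚ
  have hclosure : IsAlgClosure ℚ Qbar := ⟨inferInstance, halg⟩
  have hnormal : Normal ℚ Qbar := IsAlgClosure.normal ℚ Qbar
  set M := IntermediateField.adjoin ℚ (Set.range I.lam)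
  have : FiniteDimensional ℚ M := IntermediateField.finiteDimensional_adjoin
    fun x _ => (halg.isAlgebraic x).isIntegral
  set L := IntermediateField.normalClosure ℚ M Qbar
  have : NumberField L := ⟨⟩
  have : Normal ℚ L := normalClosure.normal ℚ M Qbar
  have : IsGalois ℚ L := ⟨⟩
  have hmem : ∀ i, I.lam i ∈ L := fun i => M.le_normalClosure
    (IntermediateField.subset_adjoin ℚ _ ⟨i, rfl⟩)
  obtain ⟨φ⟩ : Nonempty (L →+* ℂ) := inferInstance
  obtain ⟨w, hw, hw0, h⟩ := exists_card_dominantRoots_le φ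
    (x := fun i => (⟨I.lam i, hmem i⟩ : L))
    (fun i h => I.lam_ne_zero i (congrArg Subtype.val h))
    (fun i j hij n hn h => I.nondeg i j hij n hn (congrArg Subtype.val h))
    I.m_pos I.order_le
    (W := Submodule.span Qbar (Set.range I.coeff)) (by
      rw [finrank_span_eq_card I.indep, Fintype.card_fin])
  obtain ⟨β, rfl⟩ := (Submodule.mem_span_range_iff_exists_fun Qbar).1 hw
  refine ⟨β, fun hβ => hw0 (by simp [hβ]), hw0, L, hmem, inferInstance, ?_⟩
  have hdom : ∀ v : AbsoluteValue L ℝ, (Finset.univ.filter (fun i : Fin I.s =>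
      (∃ j, (∑ p, β p • I.coeff p) ⟨i, j⟩ ≠ 0) ∧
      ∀ i' : Fin I.s, (∃ j', (∑ p, β p • I.coeff p) ⟨i', j'⟩ ≠ 0) →
        v ⟨I.lam i', hmem i'⟩ ≤ v ⟨I.lam i, hmem i⟩)) =
      dominantRoots (fun i => v ⟨I.lam i, hmem i⟩) (∑ p, β p • I.coeff p) := fun v => by
    ext i
    simp only [dominantRoots, rootSupport, Finset.mem_filter, Finset.mem_univ, true_and]
  simp only [hdom]
  rcases h with ⟨v, hv, hle⟩ | hle
  · exact ⟨v, hv, fun _ => hle, fun _ => hle.trans (by norm_num)⟩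
  · exact ⟨NumberField.place φ, absNontrivial_place φ,
      fun h => absurd h (not_isNonarch_place φ), fun _ => hle⟩

end
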